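/- Let k be a field and let R be a nonzero finite-dimensional indecomposable non-unital associative k-algebra. Suppose g_1, …, g_m : R → R are maps, each of which is k-linear and multiplicative (g_t(xy) = g_t(x)·g_t(y) for all x, y ∈ R), such that g_1 + g_2 + ⋯ + g_m = id_R and such that g_i(x)·g_j(y) = 0 for all x, y ∈ R whenever i ≠ j. Then at least one g_t is bijective, i.e., an automorphism of the non-unital k-algebra R. -/

import Mathlib

universe u

/-- A bundled non-unital (associative) `k`-algebra: a `k`-vector space with an
associative `k`-bilinear multiplication (no unit required). -/
structure NuAlgebra (k : Type u) [CommRing k] : Type (u + 1) where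
  carrier : Type u
  [instNonUnitalRing : NonUnitalRing carrier]
  [instModule : Module k carrier]
  [instSMulCommClass : SMulCommClass k carrier carrier]
  [instIsScalarTower : IsScalarTower k carrier carrier]

attribute [instance] NuAlgebra.instNonUnitalRing NuAlgebra.instModule
  NuAlgebra.instSMulCommClass NuAlgebra.instIsScalarTower

/-- Two non-unital `k`-algebras are isomorphic if there is a multiplicative
`k`-linear equivalence between them. -/
def NuAlgIso (k : Type u) [CommRing k] (A B : Type u)
    [NonUnitalRing A] [Module k A] [NonUnitalRing B] [Module k B] : Prop :=
  ∃ e : A ≃ₗ[k] B, ∀ x y : A, e (x * y) = e x * e y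

/-- A non-unital `k`-algebra is decomposable if it is isomorphic, as a non-unital
`k`-algebra, to a product (with componentwise operations) of two nonzero
non-unital `k`-algebras. -/
def IsDecomposableAlg (k : Type u) [CommRing k] (A : Type u)
    [NonUnitalRing A] [Module k A] : Prop :=
  ∃ B C : NuAlgebra k, Nontrivial B.carrier ∧ Nontrivial C.carrier ∧
    NuAlgIso k A (B.carrier × C.carrier)

/-- In an indecomposable algebra, one of two complementary two-sided ideals is zero. -/
theorem eq_bot_or_eq_bot_of_isCompl_of_not_isDecomposableAlg
    {k : Type u} [Field k] {R : Type u}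
    [NonUnitalRing R] [Module k R] [SMulCommClass k R R] [IsScalarTower k R R]
    (hind : ¬ IsDecomposableAlg k R) {I J : Submodule k R} (h : IsCompl I J)
    (hIl : ∀ x, ∀ y ∈ I, x * y ∈ I) (hIr : ∀ x ∈ I, ∀ y, x * y ∈ I)
    (hJl : ∀ x, ∀ y ∈ J, x * y ∈ J) (hJr : ∀ x ∈ J, ∀ y, x * y ∈ J) :
    I = ⊥ ∨ J = ⊥ := by
  by_contra! hne
  let A : NonUnitalSubalgebra k R := I.toNonUnitalSubalgebra fun x y _ hy => hIl x y hy
  let B : NonUnitalSubalgebra k R := J.toNonUnitalSubalgebra fun x y _ hy => hJl x y hy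
  have hzero : ∀ x ∈ I, ∀ y ∈ J, x * y = 0 := fun x hx y hy =>
    Submodule.disjoint_def.mp h.disjoint _ (hIr x hx y) (hJl x y hy)
  have hzero' : ∀ x ∈ J, ∀ y ∈ I, x * y = 0 := fun x hx y hy =>
    Submodule.disjoint_def.mp h.disjoint _ (hIl x y hy) (hJr x hx y)
  let e : (A × B) ≃ₗ[k] R := Submodule.prodEquivOfIsCompl I J h
  have he : ∀ p : A × B, e p = p.1 + p.2 := fun p =>
    Submodule.coe_prodEquivOfIsCompl' I J h p
  have hmul : ∀ p q : A × B, e (p * q) = e p * e q := by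
    rintro ⟨⟨a, ha⟩, ⟨b, hb⟩⟩ ⟨⟨c, hc⟩, ⟨d, hd⟩⟩
    simp [he, mul_add, add_mul, hzero a ha d hd, hzero' b hb c hc]
  refine hind ⟨⟨A⟩, ⟨B⟩, (Submodule.nontrivial_iff_ne_bot).mpr hne.1,
    (Submodule.nontrivial_iff_ne_bot).mpr hne.2, e.symm, fun x y => ?_⟩
  apply e.injective
  rw [hmul]
  simp

/-- A linear endomorphism of an indecomposable finite-dimensional algebra that commutes with all
left and right multiplications is bijective or nilpotent. -/
theorem bijective_or_isNilpotent_of_not_isDecomposableAlg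
    {k : Type u} [Field k] {R : Type u}
    [NonUnitalRing R] [Module k R] [SMulCommClass k R R] [IsScalarTower k R R]
    [FiniteDimensional k R] (hind : ¬ IsDecomposableAlg k R) (f : R →ₗ[k] R)
    (hl : ∀ x y, f (x * y) = x * f y) (hr : ∀ x y, f (x * y) = f x * y) :
    Function.Bijective f ∨ IsNilpotent f := by
  have hpl : ∀ n x y, (f ^ n) (x * y) = x * (f ^ n) y := by
    intro n
    induction n with
    | zero => simp
    | succ n ih => intro x y; simp [pow_succ', ih, hl]
  have hpr : ∀ n x y, (f ^ n) (x * y) = (f ^ n) x * y := by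
    intro n
    induction n with
    | zero => simp
    | succ n ih => intro x y; simp [pow_succ', ih, hr]
  obtain ⟨N, hN⟩ := Filter.eventually_atTop.mp f.eventually_isCompl_ker_pow_range_pow
  have hc := hN (N + 1) N.le_succ
  rcases eq_bot_or_eq_bot_of_isCompl_of_not_isDecomposableAlg hind hc
    (fun x y hy => by simp_all [LinearMap.mem_ker])
    (fun x hx y => by rw [LinearMap.mem_ker] at *; rw [hpr, hx, zero_mul])
    (fun x y ⟨z, hz⟩ => ⟨x * z, by rw [hpl, hz]⟩)
    (fun x ⟨z, hz⟩ y => ⟨z * y, by rw [hpr, hz]⟩) with h | h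
  · left
    have hinj : Function.Injective f := by
      have := LinearMap.ker_eq_bot.mp h
      rw [pow_succ, Module.End.mul_eq_comp, LinearMap.coe_comp] at this
      exact this.of_comp
    exact ⟨hinj, LinearMap.injective_iff_surjective.mp hinj⟩
  · exact Or.inr ⟨N + 1, LinearMap.range_eq_bot.mp h⟩

/-- Let `R` be a nonzero finite-dimensional indecomposable non-unital associative
`k`-algebra and `g₁, …, g_m : R → R` be `k`-linear multiplicative maps with
`g₁ + ⋯ + g_m = id` and `gᵢ(x)·gⱼ(y) = 0` for `i ≠ j`. Then some `g_t` is an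
automorphism (i.e. bijective). This is the central step in the proof of the
paper's Theorem B. -/
theorem exists_automorphism_of_orthogonal_decomposition_of_id
    (k : Type u) [Field k] (R : Type u)
    [NonUnitalRing R] [Module k R]
    [SMulCommClass k R R] [IsScalarTower k R R]
    [Nontrivial R] [FiniteDimensional k R]
    (hind : ¬ IsDecomposableAlg k R)
    (m : ℕ) (g : Fin m → (R →ₗ[k] R))
    (hmul : ∀ t, ∀ x y : R, g t (x * y) = g t x * g t y)
    (hsum : ∑ t, g t = LinearMap.id)
    (hcross : ∀ i j, i ≠ j → ∀ x y : R, g i x * g j y = 0) :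
    ∃ t, Function.Bijective (g t) := by
  have happ : ∀ x, ∑ t, g t x = x := fun x => by
    simpa using LinearMap.congr_fun hsum x
  have hl : ∀ t x y, g t (x * y) = x * g t y := fun t x y => by
    conv_rhs => rw [← happ x, Finset.sum_mul]
    rw [Finset.sum_eq_single t (fun i _ hi => hcross i t hi x y) (by simp), hmul]
  have hr : ∀ t x y, g t (x * y) = g t x * y := fun t x y => by
    conv_rhs => rw [← happ y, Finset.mul_sum]
    rw [Finset.sum_eq_single t (fun i _ hi => hcross t i hi.symm x y) (by simp), hmul]
  by_contra! hb
  have hnil : ∀ t, IsNilpotent (g t) := fun t =>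
    (bijective_or_isNilpotent_of_not_isDecomposableAlg hind (g t) (hl t) (hr t)).resolve_left
      (hb t)
  have hidem : ∀ t x y, g t (g t (x * y)) = g t (x * y) := fun t x y => by
    rw [hl t x y, hr, ← hmul, hl]
  have hsq : ∀ t x y, g t (x * y) = 0 := fun t x y => by
    obtain ⟨n, hn⟩ := hnil t
    have hfix : (g t ^ n) (g t (x * y)) = g t (x * y) := by
      rw [Module.End.pow_apply]
      exact Function.iterate_fixed (hidem t x y) n
    rw [← hfix, hn, LinearMap.zero_apply]
  have hzero : ∀ x y : R, x * y = 0 := fun x y => by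
    rw [← happ (x * y)]
    exact Finset.sum_eq_zero fun t _ => hsq t x y
  have hg : ∀ t, g t = 0 := fun t => by
    obtain ⟨J, hJ⟩ := (LinearMap.ker (g t)).exists_isCompl
    rcases eq_bot_or_eq_bot_of_isCompl_of_not_isDecomposableAlg hind hJ
      (by simp [hzero]) (by simp [hzero]) (by simp [hzero]) (by simp [hzero]) with h | h
    · have hinj := LinearMap.ker_eq_bot.mp h
      exact absurd ⟨hinj, LinearMap.injective_iff_surjective.mp hinj⟩ (hb t)
    · rw [h] at hJ
      exact LinearMap.ker_eq_top.mp (eq_top_of_isCompl_bot hJ)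
  obtain ⟨x, hx⟩ := exists_ne (0 : R)
  exact hx (by rw [← happ x]; simp [hg])
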